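/- Let m ≥ 1 be a natural number, n = 2m, α ∈ [0, 1/2], and ζ > 0. Let (Ω, ℱ, P) be a probability space, H a nonempty set, Ln : Ω → H → ℝ a random empirical risk functional, w_m : Ω → H a random initial point, w_n* : Ω → H a random element that almost surely minimizes Ln over H, and for each natural number T ≥ 1 let w_T : Ω → H denote the T-th iterate of an optimization algorithm started from w_m. Assume integrability of the relevant compositions and: (i) the sublinear convergence bound E[Ln(w_T) − Ln(w_n*)] ≤ (1/T^ζ)·E[Ln(w_m) − Ln(w_n*)] for all T ≥ 1; (ii) the initialization bound E[Ln(w_m) − Ln(w_n*)] ≤ (1/m^α) + (1/2)·(3 + 1/2^α)·(1/m^α). Then for every natural number T with T ≥ (2^α·(5/2 + 1/2^{α+1}))^{1/ζ}, one has E[Ln(w_T) − Ln(w_n*)] ≤ 1/n^α. -/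

import Mathlib

open MeasureTheory ProbabilityTheory

/-- **Theorem 2 (iteration count for sublinear algorithms).**
For a sublinearly convergent algorithm with exponent `ζ > 0` started at `wm`, whose
initial optimality gap satisfies the adaptive-sampling bound
`E[Ln(wm) − Ln(wns)] ≤ 1/m^α + (1/2)·(3 + 1/2^α)·(1/m^α)`, any iteration count
`T ≥ (2^α·(5/2 + 1/2^(α+1)))^(1/ζ)` solves the ERM on the sample of size `n = 2m`
within its statistical accuracy `1/n^α`. -/
theorem sublinear_iterations_for_statistical_accuracy
    {Ω : Type*} [MeasureSpace Ω] [IsProbabilityMeasure (ℙ : Measure Ω)]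
    {H : Type*} [Nonempty H]
    (m n : ℕ) (hm : 1 ≤ m) (hn : n = 2 * m)
    (α : ℝ) (hα0 : 0 ≤ α) (hα1 : α ≤ 1 / 2)
    (ζ : ℝ) (hζ : 0 < ζ)
    (Ln : Ω → H → ℝ) (wm : Ω → H) (wns : Ω → H) (wT : ℕ → Ω → H)
    (hwns : ∀ᵐ ω ∂ℙ, ∀ w, Ln ω (wns ω) ≤ Ln ω w)
    -- integrability of the relevant compositions
    (hintm : Integrable (fun ω => Ln ω (wm ω)) ℙ)
    (hintns : Integrable (fun ω => Ln ω (wns ω)) ℙ)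
    (hintT : ∀ T : ℕ, Integrable (fun ω => Ln ω (wT T ω)) ℙ)
    -- (i) sublinear convergence bound
    (hconv : ∀ T : ℕ, 1 ≤ T →
      ∫ ω, (Ln ω (wT T ω) - Ln ω (wns ω)) ∂ℙ ≤
        (1 / (T : ℝ) ^ ζ) * ∫ ω, (Ln ω (wm ω) - Ln ω (wns ω)) ∂ℙ)
    -- (ii) initialization bound
    (hinit : ∫ ω, (Ln ω (wm ω) - Ln ω (wns ω)) ∂ℙ ≤
      1 / (m : ℝ) ^ α + (1 / 2) * (3 + 1 / (2 : ℝ) ^ α) * (1 / (m : ℝ) ^ α)) :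
    ∀ T : ℕ, ((2 : ℝ) ^ α * (5 / 2 + 1 / 2 ^ (α + 1))) ^ (1 / ζ) ≤ (T : ℝ) →
      ∫ ω, (Ln ω (wT T ω) - Ln ω (wns ω)) ∂ℙ ≤ 1 / (n : ℝ) ^ α := by
  intro T hT
  have hp : (0 : ℝ) < (2 : ℝ) ^ α := by positivity
  have hq : (0 : ℝ) < (m : ℝ) ^ α := Real.rpow_pos_of_pos (by exact_mod_cast hm) α
  have hK : (0 : ℝ) < (2 : ℝ) ^ α * (5 / 2 + 1 / 2 ^ (α + 1)) := by positivity
  have hTpos : (0 : ℝ) < T := (Real.rpow_pos_of_pos hK _).trans_le hT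
  have hTζ : (2 : ℝ) ^ α * (5 / 2 + 1 / 2 ^ (α + 1)) ≤ (T : ℝ) ^ ζ := by
    rwa [one_div ζ, Real.rpow_inv_le_iff_of_pos hK.le hTpos.le hζ] at hT
  have hn' : (n : ℝ) ^ α = (2 : ℝ) ^ α * (m : ℝ) ^ α := by
    rw [hn, Nat.cast_mul, Nat.cast_ofNat, Real.mul_rpow zero_le_two m.cast_nonneg]
  have hgap : 1 / (m : ℝ) ^ α + (1 / 2) * (3 + 1 / (2 : ℝ) ^ α) * (1 / (m : ℝ) ^ α) =
      ((2 : ℝ) ^ α * (5 / 2 + 1 / 2 ^ (α + 1))) * (1 / (n : ℝ) ^ α) := by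
    rw [hn', Real.rpow_add_one two_ne_zero]
    field_simp
    ring
  have hTζpos : (0 : ℝ) < (T : ℝ) ^ ζ := hK.trans_le hTζ
  calc ∫ ω, (Ln ω (wT T ω) - Ln ω (wns ω)) ∂ℙ
      ≤ (1 / (T : ℝ) ^ ζ) * ∫ ω, (Ln ω (wm ω) - Ln ω (wns ω)) ∂ℙ :=
        hconv T (by exact_mod_cast hTpos)
    _ ≤ (1 / (T : ℝ) ^ ζ) * ((T : ℝ) ^ ζ * (1 / (n : ℝ) ^ α)) := by
        refine mul_le_mul_of_nonneg_left (hinit.trans ?_) (by positivity)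
        rw [hgap]
        exact mul_le_mul_of_nonneg_right hTζ (by positivity)
    _ = 1 / (n : ℝ) ^ α := by
        rw [← mul_assoc, one_div_mul_cancel hTζpos.ne', one_mul]
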